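/- arXiv:2204.13758 — 4 statements merged into one kernel-verified Lean document; each statement's English description precedes it below -/
import Mathlib

section
/- If L is an EDT0L language over a finite alphabet U and K ⊆ U* is a regular language, then L ∩ K is an EDT0L language over U. -/
/-- An EDT0L system over the terminal alphabet `U` consists of a finite extended
alphabet `V` containing `U` (via an embedding `emb`), a finite set `T` of tables,
each table being an endomorphism of the free monoid `V*` (specified by its value
`tab t : V → List V` on letters, extended by `List.flatMap`), a regular rational
control `R ⊆ T*`, and an axiom `v₀ ∈ V*`.  A language `L ⊆ U*` is EDT0L if it is
the set of words over `U` obtained from `v₀` by applying the tables of some word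
of `R` in order from left to right. -/
def IsEDT0L {U : Type} [Fintype U] (L : Language U) : Prop :=
  ∃ (V : Type) (_ : Fintype V) (emb : U ↪ V) (T : Type) (_ : Fintype T)
    (tab : T → V → List V) (R : Language T) (v₀ : List V),
    R.IsRegular ∧
    L = { w : List U | ∃ ts ∈ R,
      ts.foldl (fun u t => u.flatMap (tab t)) v₀ = w.map emb }

/-- The DFA reading control words backwards, whose state records, for each letter of `V`, the
transformation of `σ` induced by the word it is finally rewritten to. -/
def revDFA {V T σ : Type} (tab : T → V → List V) (f₀ : V → σ → σ) (acc : Set (V → σ → σ)) :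
    DFA T (V → σ → σ) where
  step f t := fun v s => (tab t v).foldl (fun s v => f v s) s
  start := f₀
  accept := acc

theorem revDFA_eval {V T σ : Type} (tab : T → V → List V) (f₀ : V → σ → σ)
    (acc : Set (V → σ → σ)) (ts : List T) (v₀ : List V) (s : σ) :
    v₀.foldl (fun s v => (revDFA tab f₀ acc).eval ts.reverse v s) s =
      (ts.foldl (fun u t => u.flatMap (tab t)) v₀).foldl (fun s v => f₀ v s) s := by
  induction ts generalizing v₀ with
  | nil => rfl
  | cons t ts ih =>
    rw [List.foldl_cons, ← ih, List.foldl_flatMap, List.reverse_cons, DFA.eval_append_singleton]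
    rfl

/-- The intersection of an EDT0L language with a regular language is EDT0L. -/
theorem isEDT0L_inter_regular {U : Type} [Fintype U] (L K : Language U)
    (hL : IsEDT0L L) (hK : K.IsRegular) :
    IsEDT0L { w : List U | w ∈ L ∧ w ∈ K } := by
  classical
  obtain ⟨V, iV, emb, T, iT, tab, R, v₀, hR, rfl⟩ := hL
  obtain ⟨σ, iσ, M, rfl⟩ := hK
  let f₀ : V → σ → σ := fun v s => if h : ∃ u, emb u = v then M.step s h.choose else s
  have hf₀ : ∀ u s, f₀ (emb u) s = M.step s u := by
    intro u s
    have h : ∃ u', emb u' = emb u := ⟨u, rfl⟩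
    simp only [f₀, dif_pos h]
    rw [emb.injective h.choose_spec]
  let acc : Set (V → σ → σ) := {f | v₀.foldl (fun s v => f v s) M.start ∈ M.accept}
  let D := revDFA tab f₀ acc
  have hD : D.accepts.IsRegular := ⟨_, inferInstance, D, rfl⟩
  refine ⟨V, iV, emb, T, iT, tab, R ⊓ D.accepts.reverse, v₀, hR.inf hD.reverse, ?_⟩
  have key : ∀ (ts : List T) (w : List U),
      ts.foldl (fun u t => u.flatMap (tab t)) v₀ = w.map emb →
      (ts ∈ D.accepts.reverse ↔ w ∈ M.accepts) := by
    intro ts w h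
    have h1 := revDFA_eval tab f₀ acc ts v₀ M.start
    rw [h, List.foldl_map] at h1
    simp only [hf₀] at h1
    rw [Language.mem_reverse, DFA.mem_accepts, DFA.mem_accepts]
    change v₀.foldl (fun s v => (revDFA tab f₀ acc).eval ts.reverse v s) M.start ∈ M.accept ↔ _
    rw [h1]
    rfl
  ext w
  constructor
  · rintro ⟨⟨ts, hts, h⟩, hw⟩
    exact ⟨ts, ⟨hts, (key ts w h).2 hw⟩, h⟩
  · rintro ⟨ts, ⟨hts, hts'⟩, h⟩
    exact ⟨⟨ts, hts, h⟩, (key ts w h).1 hts'⟩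
end

section
/- If L₁ and L₂ are EDT0L languages over a finite alphabet U, then their concatenation L₁L₂ = {uv : u ∈ L₁, v ∈ L₂} is an EDT0L language over U. -/
namespace EDT0LConcat

open Classical in
/-- Product automaton for the shuffle of two controls followed by the final table. -/
noncomputable def shuffleDFA {T₁ T₂ S₁ S₂ : Type} (M₁ : DFA T₁ S₁) (M₂ : DFA T₂ S₂) :
    DFA (Option (T₁ ⊕ T₂)) (Option (Option (S₁ × S₂))) where
  step
    | some (some (p, q)), some (Sum.inl t) => some (some (M₁.step p t, q))
    | some (some (p, q)), some (Sum.inr t) => some (some (p, M₂.step q t))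
    | some (some (p, q)), none => if p ∈ M₁.accept ∧ q ∈ M₂.accept then some none else none
    | some none, _ => none
    | none, _ => none
  start := some (some (M₁.start, M₂.start))
  accept := {some none}

section
variable {T₁ T₂ S₁ S₂ : Type} (M₁ : DFA T₁ S₁) (M₂ : DFA T₂ S₂)

theorem eval_dead (ts : List (Option (T₁ ⊕ T₂))) :
    (shuffleDFA M₁ M₂).evalFrom none ts = none := by
  induction ts with
  | nil => rfl
  | cons t ts ih => rw [DFA.evalFrom_cons]; exact ih

theorem eval_done (ts : List (Option (T₁ ⊕ T₂))) :
    (shuffleDFA M₁ M₂).evalFrom (some none) ts = some none ↔ ts = [] := by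
  cases ts with
  | nil => simp
  | cons t ts =>
    rw [DFA.evalFrom_cons]
    have : (shuffleDFA M₁ M₂).step (some none) t = none := rfl
    rw [this, eval_dead]; simp

open Classical in
theorem eval_live (ts : List (Option (T₁ ⊕ T₂))) (p : S₁) (q : S₂) :
    (shuffleDFA M₁ M₂).evalFrom (some (some (p, q))) ts = some none ↔
      ∃ xs : List (T₁ ⊕ T₂), ts = xs.map some ++ [none] ∧
        M₁.evalFrom p (xs.filterMap Sum.getLeft?) ∈ M₁.accept ∧
        M₂.evalFrom q (xs.filterMap Sum.getRight?) ∈ M₂.accept := by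
  induction ts generalizing p q with
  | nil => simp
  | cons t ts ih =>
    rw [DFA.evalFrom_cons]
    rcases t with _ | t | t
    · have h : (shuffleDFA M₁ M₂).step (some (some (p, q))) none =
        if p ∈ M₁.accept ∧ q ∈ M₂.accept then some none else none := rfl
      rw [h]
      constructor
      · intro h
        split_ifs at h with h'
        · rw [eval_done] at h
          exact ⟨[], by simp [h], by simpa using h'.1, by simpa using h'.2⟩
        · rw [eval_dead] at h; simp at h
      · rintro ⟨xs, h, h1, h2⟩
        cases xs with
        | nil =>
          simp at h h1 h2
          rw [if_pos ⟨h1, h2⟩, eval_done]; exact h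
        | cons x xs => simp at h
    · have h : (shuffleDFA M₁ M₂).step (some (some (p, q))) (some (Sum.inl t)) =
        some (some (M₁.step p t, q)) := rfl
      rw [h, ih]
      constructor
      · rintro ⟨xs, h, h1, h2⟩
        exact ⟨Sum.inl t :: xs, by simp [h], by simpa [List.filterMap_cons] using h1,
          by simpa [List.filterMap_cons] using h2⟩
      · rintro ⟨xs, h, h1, h2⟩
        cases xs with
        | nil => simp at h
        | cons x xs =>
          simp only [List.map_cons, List.cons_append, List.cons.injEq, Option.some.injEq] at h
          obtain ⟨rfl, h⟩ := h
          exact ⟨xs, h, by simpa [List.filterMap_cons] using h1,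
            by simpa [List.filterMap_cons] using h2⟩
    · have h : (shuffleDFA M₁ M₂).step (some (some (p, q))) (some (Sum.inr t)) =
        some (some (p, M₂.step q t)) := rfl
      rw [h, ih]
      constructor
      · rintro ⟨xs, h, h1, h2⟩
        exact ⟨Sum.inr t :: xs, by simp [h], by simpa [List.filterMap_cons] using h1,
          by simpa [List.filterMap_cons] using h2⟩
      · rintro ⟨xs, h, h1, h2⟩
        cases xs with
        | nil => simp at h
        | cons x xs =>
          simp only [List.map_cons, List.cons_append, List.cons.injEq, Option.some.injEq] at h
          obtain ⟨rfl, h⟩ := h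
          exact ⟨xs, h, by simpa [List.filterMap_cons] using h1,
            by simpa [List.filterMap_cons] using h2⟩

end

section
variable {U V₁ V₂ T₁ T₂ : Type} (e₁ : U ↪ V₁) (e₂ : U ↪ V₂)
  (tab₁ : T₁ → V₁ → List V₁) (tab₂ : T₂ → V₂ → List V₂)

/-- The final table on letters: terminals become honest terminals, other letters are fixed. -/
noncomputable def fin {W V : Type} (e : U ↪ V) (i : V → W) (v : V) : W ⊕ U :=
  match Function.partialInv e v with
  | some u => Sum.inr u
  | none => Sum.inl (i v)

theorem fin_eq {W V : Type} (e : U ↪ V) (i : V → W) (v : V) (u : U) :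
    fin e i v = Sum.inr u ↔ v = e u := by
  have h := Function.Injective.isPartialInv e.injective u v
  unfold fin
  constructor
  · intro h'
    split at h'
    · next w hw =>
      cases h'
      exact (h.1 hw).symm
    · cases h'
  · intro h'
    rw [h.2 h'.symm]

theorem map_fin_eq {W V : Type} (e : U ↪ V) (i : V → W) (x : List V) (w : List U) :
    x.map (fin e i) = w.map Sum.inr ↔ x = w.map e := by
  induction x generalizing w with
  | nil => cases w <;> simp
  | cons a x ih => cases w <;> simp [fin_eq, ih]

/-- Tables of the concatenation system. -/
noncomputable def tab : Option (T₁ ⊕ T₂) → (V₁ ⊕ V₂) ⊕ U → List ((V₁ ⊕ V₂) ⊕ U)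
  | some (Sum.inl t), Sum.inl (Sum.inl v) => (tab₁ t v).map (Sum.inl ∘ Sum.inl)
  | some (Sum.inr t), Sum.inl (Sum.inr v) => (tab₂ t v).map (Sum.inl ∘ Sum.inr)
  | none, Sum.inl (Sum.inl v) => [fin e₁ Sum.inl v]
  | none, Sum.inl (Sum.inr v) => [fin e₂ Sum.inr v]
  | _, x => [x]

/-- A pair of words placed side by side. -/
def pair (x : List V₁) (y : List V₂) : List ((V₁ ⊕ V₂) ⊕ U) :=
  x.map (Sum.inl ∘ Sum.inl) ++ y.map (Sum.inl ∘ Sum.inr)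

theorem step_inl (t : T₁) (x : List V₁) (y : List V₂) :
    (pair x y).flatMap (tab e₁ e₂ tab₁ tab₂ (some (Sum.inl t))) =
      pair (x.flatMap (tab₁ t)) y := by
  simp only [pair, List.flatMap_append, List.flatMap_map, List.map_flatMap]
  congr 1
  simp [Function.comp_def, tab, List.map_eq_flatMap]

theorem step_inr (t : T₂) (x : List V₁) (y : List V₂) :
    (pair x y).flatMap (tab e₁ e₂ tab₁ tab₂ (some (Sum.inr t))) =
      pair x (y.flatMap (tab₂ t)) := by
  simp only [pair, List.flatMap_append, List.flatMap_map, List.map_flatMap]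
  congr 1
  simp [Function.comp_def, tab, List.map_eq_flatMap]

theorem step_none (x : List V₁) (y : List V₂) :
    (pair x y).flatMap (tab e₁ e₂ tab₁ tab₂ none) =
      x.map (fin e₁ Sum.inl) ++ y.map (fin e₂ Sum.inr) := by
  simp only [pair, List.flatMap_append, List.flatMap_map]
  simp [Function.comp_def, tab, List.map_eq_flatMap]

theorem fold_eq (xs : List (T₁ ⊕ T₂)) (x : List V₁) (y : List V₂) :
    (xs.map some).foldl (fun u t => u.flatMap (tab e₁ e₂ tab₁ tab₂ t)) (pair x y) =
      pair ((xs.filterMap Sum.getLeft?).foldl (fun u t => u.flatMap (tab₁ t)) x)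
        ((xs.filterMap Sum.getRight?).foldl (fun u t => u.flatMap (tab₂ t)) y) := by
  induction xs generalizing x y with
  | nil => rfl
  | cons t xs ih =>
    rcases t with t | t
    · simp only [List.map_cons, List.foldl_cons, step_inl, ih]
      simp [List.filterMap_cons]
    · simp only [List.map_cons, List.foldl_cons, step_inr, ih]
      simp [List.filterMap_cons]

end

end EDT0LConcat

/-- The concatenation of two EDT0L languages over a finite alphabet is EDT0L. -/
theorem isEDT0L_concat {U : Type} [Fintype U] (L₁ L₂ : Language U)
    (h₁ : IsEDT0L L₁) (h₂ : IsEDT0L L₂) :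
    IsEDT0L { w : List U | ∃ u ∈ L₁, ∃ v ∈ L₂, w = u ++ v } := by
  obtain ⟨V₁, _, e₁, T₁, _, tab₁, R₁, a₁, ⟨S₁, _, M₁, rfl⟩, rfl⟩ := h₁
  obtain ⟨V₂, _, e₂, T₂, _, tab₂, R₂, a₂, ⟨S₂, _, M₂, rfl⟩, rfl⟩ := h₂
  refine ⟨(V₁ ⊕ V₂) ⊕ U, inferInstance, ⟨Sum.inr, Sum.inr_injective⟩, Option (T₁ ⊕ T₂),
    inferInstance, EDT0LConcat.tab e₁ e₂ tab₁ tab₂, (EDT0LConcat.shuffleDFA M₁ M₂).accepts,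
    EDT0LConcat.pair a₁ a₂, ⟨_, inferInstance, _, rfl⟩, ?_⟩
  have key : ∀ ts, ts ∈ (EDT0LConcat.shuffleDFA M₁ M₂).accepts ↔
      ∃ xs : List (T₁ ⊕ T₂), ts = xs.map some ++ [none] ∧
        xs.filterMap Sum.getLeft? ∈ M₁.accepts ∧ xs.filterMap Sum.getRight? ∈ M₂.accepts :=
    fun ts => EDT0LConcat.eval_live M₁ M₂ ts M₁.start M₂.start
  apply Set.ext
  intro w
  constructor
  · rintro ⟨u, ⟨xs, hxs, hu⟩, v, ⟨ys, hys, hv⟩, rfl⟩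
    have hl : (xs.map (Sum.inl : T₁ → T₁ ⊕ T₂) ++ ys.map Sum.inr).filterMap Sum.getLeft? = xs := by
      simp [List.filterMap_map, Function.comp_def]
    have hr : (xs.map (Sum.inl : T₁ → T₁ ⊕ T₂) ++ ys.map Sum.inr).filterMap Sum.getRight? = ys := by
      simp [List.filterMap_map, Function.comp_def]
    refine ⟨_, (key _).2 ⟨xs.map Sum.inl ++ ys.map Sum.inr, rfl, ?_, ?_⟩, ?_⟩
    · rw [hl]; exact hxs
    · rw [hr]; exact hys
    · rw [List.foldl_append, EDT0LConcat.fold_eq, hl, hr, hu, hv]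
      simp only [List.foldl_cons, List.foldl_nil, EDT0LConcat.step_none, List.map_append]
      rw [(EDT0LConcat.map_fin_eq e₁ _ _ u).2 rfl, (EDT0LConcat.map_fin_eq e₂ _ _ v).2 rfl]
      rfl
  · rintro ⟨ts, hts, hw⟩
    obtain ⟨xs, rfl, h1, h2⟩ := (key ts).1 hts
    rw [List.foldl_append, EDT0LConcat.fold_eq] at hw
    simp only [List.foldl_cons, List.foldl_nil, EDT0LConcat.step_none] at hw
    obtain ⟨u, v, rfl, hu, hv⟩ := List.map_eq_append_iff.1 hw.symm
    exact ⟨u, ⟨_, h1, (EDT0LConcat.map_fin_eq e₁ _ _ u).1 hu.symm⟩,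
      v, ⟨_, h2, (EDT0LConcat.map_fin_eq e₂ _ _ v).1 hv.symm⟩, rfl⟩
end

section
/- If L is an EDT0L language over a finite alphabet U, then its Kleene star L* (the set of all concatenations of finitely many words of L, including the empty word) is an EDT0L language over U. -/
open Classical in
/-- Tables of the star system. Letters: `inl o` is a controller (idle, or in a state of the
automaton), `inr (inl v)` a working letter, `inr (inr (some u))` a finished letter and
`inr (inr none)` a dead letter. -/
noncomputable def starTab {U V T σ : Type} (emb : U ↪ V) (tab : T → V → List V) (M : DFA T σ)
    (v₀ : List V) : T ⊕ Option Bool → Option σ ⊕ V ⊕ Option U → List (Option σ ⊕ V ⊕ Option U)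
  | _, .inr (.inr x) => [.inr (.inr x)]
  | .inl t, .inl (some s) => [.inl (some (M.step s t))]
  | .inl _, .inl none => [.inr (.inr none)]
  | .inl t, .inr (.inl v) => (tab t v).map (fun v => .inr (.inl v))
  | .inr none, .inl none => v₀.map (fun v => .inr (.inl v)) ++ [.inl (some M.start)]
  | .inr none, _ => [.inr (.inr none)]
  | .inr (some true), .inl (some s) => if s ∈ M.accept then [.inl none] else [.inr (.inr none)]
  | .inr (some true), .inl none => [.inr (.inr none)]
  | .inr (some true), .inr (.inl v) =>
      if h : ∃ u, emb u = v then [.inr (.inr (some h.choose))] else [.inr (.inr none)]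
  | .inr (some false), .inl none => []
  | .inr (some false), _ => [.inr (.inr none)]

section
variable {U V T σ : Type} (emb : U ↪ V) (tab : T → V → List V) (M : DFA T σ) (v₀ : List V)

lemma starTab_fin (t : T ⊕ Option Bool) (w : List U) :
    (w.map (fun u => (.inr (.inr (some u)) : Option σ ⊕ V ⊕ Option U))).flatMap
      (starTab emb tab M v₀ t) = w.map (fun u => .inr (.inr (some u))) := by
  induction w with
  | nil => rfl
  | cons a w ih => simp only [List.map_cons, List.flatMap_cons, ih]; simp [starTab]

lemma starTab_work (t : T) (x : List V) :
    (x.map (fun v => (.inr (.inl v) : Option σ ⊕ V ⊕ Option U))).flatMap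
      (starTab emb tab M v₀ (.inl t)) = (x.flatMap (tab t)).map (fun v => .inr (.inl v)) := by
  induction x with
  | nil => rfl
  | cons a w ih => simp only [List.map_cons, List.flatMap_cons, ih]; simp [starTab]

lemma starTab_freeze (w : List U) :
    ((w.map emb).map (fun v => (.inr (.inl v) : Option σ ⊕ V ⊕ Option U))).flatMap
      (starTab emb tab M v₀ (.inr (some true))) = w.map (fun u => .inr (.inr (some u))) := by
  induction w with
  | nil => rfl
  | cons a w ih => simp only [List.map_cons, List.flatMap_cons, ih]; simp [starTab]

lemma starTab_freeze_cases (x : List V) :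
    (.inr (.inr none)) ∈ ((x.map (fun v => (.inr (.inl v) : Option σ ⊕ V ⊕ Option U))).flatMap
      (starTab emb tab M v₀ (.inr (some true)))) ∨ ∃ w : List U, x = w.map emb := by
  induction x with
  | nil => exact .inr ⟨[], rfl⟩
  | cons a x ih =>
    rcases ih with ih | ⟨w, rfl⟩
    · left
      rw [List.map_cons, List.flatMap_cons]
      exact List.mem_append_right _ ih
    · by_cases h : ∃ u, emb u = a
      · obtain ⟨u, rfl⟩ := h
        exact .inr ⟨u :: w, rfl⟩
      · left
        rw [List.map_cons, List.flatMap_cons]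
        refine List.mem_append_left _ ?_
        simp [starTab, h]

/-- Invariant of the star system. -/
def StarInv (K : Set (List U)) (y : List (Option σ ⊕ V ⊕ Option U)) : Prop :=
  (.inr (.inr none)) ∈ y ∨ ∃ w ∈ K, y = w.map (fun u => .inr (.inr (some u))) ∨
    y = w.map (fun u => .inr (.inr (some u))) ++ [.inl none] ∨
    ∃ ts : List T, y = w.map (fun u => .inr (.inr (some u))) ++
      ((ts.foldl (fun u t => u.flatMap (tab t)) v₀).map (fun v => .inr (.inl v)) ++
        [.inl (some (M.eval ts))])

lemma starInv_step (K : Set (List U))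
    (hK : ∀ w ∈ K, ∀ w' : List U, (∃ ts ∈ M.accepts,
      ts.foldl (fun u t => u.flatMap (tab t)) v₀ = w'.map emb) → w ++ w' ∈ K)
    (y) (hy : StarInv tab M v₀ K y) (t) :
    StarInv tab M v₀ K (y.flatMap (starTab emb tab M v₀ t)) := by
  rcases hy with hd | ⟨w, hw, rfl | rfl | ⟨ts, rfl⟩⟩
  · left
    exact List.mem_flatMap.2 ⟨_, hd, by simp [starTab]⟩
  · rw [starTab_fin]
    exact .inr ⟨w, hw, .inl rfl⟩
  · rw [List.flatMap_append, starTab_fin]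
    rcases t with t | _ | _ | _
    · left; simp [starTab]
    · exact .inr ⟨w, hw, .inr (.inr ⟨[], by simp [starTab]⟩)⟩
    · exact .inr ⟨w, hw, .inl (by simp [starTab])⟩
    · left; simp [starTab]
  · rw [List.flatMap_append, starTab_fin, List.flatMap_append]
    rcases t with t | _ | _ | _
    · rw [starTab_work]
      exact .inr ⟨w, hw, .inr (.inr ⟨ts ++ [t], by simp [starTab]⟩)⟩
    · left; simp [starTab]
    · left; simp [starTab]
    · by_cases ha : M.eval ts ∈ M.accept
      · rcases starTab_freeze_cases emb tab M v₀ (ts.foldl (fun u t => u.flatMap (tab t)) v₀)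
          with h | ⟨w', h⟩
        · exact .inl (List.mem_append_right _ (List.mem_append_left _ h))
        · refine .inr ⟨w ++ w', hK w hw w' ⟨ts, ha, h⟩, .inr (.inl ?_)⟩
          rw [h, starTab_freeze]
          simp [starTab, ha]
      · left; simp [starTab, ha]

lemma starTab_run (w : List U) (ts acc : List T) :
    (ts.map Sum.inl).foldl (fun u t => u.flatMap (starTab emb tab M v₀ t))
      (w.map (fun u => .inr (.inr (some u))) ++
      ((acc.foldl (fun u t => u.flatMap (tab t)) v₀).map (fun v => .inr (.inl v)) ++
        [.inl (some (M.eval acc))])) =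
      w.map (fun u => .inr (.inr (some u))) ++
      (((acc ++ ts).foldl (fun u t => u.flatMap (tab t)) v₀).map (fun v => .inr (.inl v)) ++
        [.inl (some (M.eval (acc ++ ts)))]) := by
  induction ts generalizing acc with
  | nil => simp
  | cons t ts ih =>
    have := ih (acc ++ [t])
    rw [List.append_assoc, List.singleton_append] at this
    rw [← this, List.map_cons, List.foldl_cons, List.flatMap_append, starTab_fin,
      List.flatMap_append, starTab_work]
    simp [starTab]

lemma starTab_block (w w' : List U) (h : ∃ ts ∈ M.accepts,
      ts.foldl (fun u t => u.flatMap (tab t)) v₀ = w'.map emb) :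
    ∃ ts : List (T ⊕ Option Bool), ts.foldl (fun u t => u.flatMap (starTab emb tab M v₀ t))
      (w.map (fun u => .inr (.inr (some u))) ++ [.inl none]) =
      (w ++ w').map (fun u => .inr (.inr (some u))) ++ [.inl none] := by
  obtain ⟨ts, ha, h⟩ := h
  refine ⟨.inr none :: (ts.map .inl ++ [.inr (some true)]), ?_⟩
  have h1 := starTab_run emb tab M v₀ w ts []
  rw [List.nil_append, h] at h1
  have ha' : M.eval ts ∈ M.accept := ha
  have h0 : (w.map (fun u => (.inr (.inr (some u)) : Option σ ⊕ V ⊕ Option U)) ++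
      [(.inl none : Option σ ⊕ V ⊕ Option U)]).flatMap
      (starTab emb tab M v₀ (.inr none)) = w.map (fun u => .inr (.inr (some u))) ++
      ((([] : List T).foldl (fun u t => u.flatMap (tab t)) v₀).map (fun v => .inr (.inl v)) ++
        [.inl (some (M.eval []))]) := by
    rw [List.flatMap_append, starTab_fin]; simp [starTab]
  rw [List.foldl_cons, h0, List.foldl_append, h1, List.foldl_cons, List.foldl_nil,
    List.flatMap_append, starTab_fin, List.flatMap_append, starTab_freeze]
  simp [starTab, ha']

end

/-- The Kleene star of an EDT0L language over a finite alphabet is EDT0L. -/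
theorem isEDT0L_kstar {U : Type} [Fintype U] (L : Language U)
    (hL : IsEDT0L L) :
    IsEDT0L { w : List U | ∃ ws : List (List U), (∀ u ∈ ws, u ∈ L) ∧ w = ws.flatten } := by
  obtain ⟨V, _, emb, T, _, tab, R, v₀, ⟨σ, _, M, rfl⟩, rfl⟩ := hL
  refine ⟨Option σ ⊕ V ⊕ Option U, inferInstance,
    ⟨fun u => .inr (.inr (some u)), fun a b h => by simpa using h⟩, T ⊕ Option Bool,
    inferInstance, starTab emb tab M v₀, Set.univ, [.inl none], ?_, ?_⟩
  · refine ⟨Unit, inferInstance, ⟨fun _ _ => (), (), Set.univ⟩, ?_⟩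
    ext x
    exact ⟨fun _ => trivial, fun _ => trivial⟩
  ext w
  constructor
  · rintro ⟨ws, hws, rfl⟩
    have key : ∀ (ws : List (List U)) (w : List U), (∀ u ∈ ws, ∃ ts ∈ M.accepts,
        ts.foldl (fun u t => u.flatMap (tab t)) v₀ = u.map emb) →
        ∃ ts : List (T ⊕ Option Bool), ts.foldl (fun u t => u.flatMap (starTab emb tab M v₀ t))
          (w.map (fun u => .inr (.inr (some u))) ++ [.inl none]) =
          (w ++ ws.flatten).map (fun u => .inr (.inr (some u))) ++ [.inl none] := by
      intro ws
      induction ws with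
      | nil => intro w _; exact ⟨[], by simp⟩
      | cons a ws ih =>
        intro w h
        obtain ⟨t1, h1⟩ := starTab_block emb tab M v₀ w a (h a (by simp))
        obtain ⟨t2, h2⟩ := ih (w ++ a) (fun u hu => h u (by simp [hu]))
        refine ⟨t1 ++ t2, ?_⟩
        rw [List.foldl_append, h1, h2]
        simp
    obtain ⟨ts, h⟩ := key ws [] hws
    refine ⟨ts ++ [.inr (some false)], trivial, ?_⟩
    rw [List.map_nil, List.nil_append, List.nil_append] at h
    rw [List.foldl_append, h, List.foldl_cons, List.foldl_nil, List.flatMap_append, starTab_fin,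
      List.flatMap_singleton]
    exact List.append_nil _
  · rintro ⟨ts, -, h⟩
    have key : ∀ (ts : List (T ⊕ Option Bool)) (y), StarInv tab M v₀
        { w : List U | ∃ ws : List (List U), (∀ u ∈ ws, ∃ ts ∈ M.accepts,
        ts.foldl (fun u t => u.flatMap (tab t)) v₀ = u.map emb) ∧ w = ws.flatten } y →
        StarInv tab M v₀ { w : List U | ∃ ws : List (List U), (∀ u ∈ ws, ∃ ts ∈ M.accepts,
        ts.foldl (fun u t => u.flatMap (tab t)) v₀ = u.map emb) ∧ w = ws.flatten }
        (ts.foldl (fun u t => u.flatMap (starTab emb tab M v₀ t)) y) := by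
      intro ts
      induction ts with
      | nil => intro y hy; exact hy
      | cons t ts ih =>
        intro y hy
        refine ih _ (starInv_step emb tab M v₀ _ ?_ y hy t)
        rintro w ⟨ws, hws, rfl⟩ w' hw'
        refine ⟨ws ++ [w'], ?_, by simp⟩
        intro u hu
        rcases List.mem_append.1 hu with hu | hu
        · exact hws u hu
        · rw [List.mem_singleton.1 hu]; exact hw'
    have := key ts [.inl none] (.inr ⟨[], ⟨[], by simp, rfl⟩, .inr (.inl rfl)⟩)
    rw [h] at this
    rcases this with hd | ⟨w', hw', h' | h' | ⟨ts, h'⟩⟩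
    · obtain ⟨a, -, ha⟩ := List.mem_map.1 hd
      have ha' : (.inr (.inr (some a)) : Option σ ⊕ V ⊕ Option U) = .inr (.inr none) := ha
      simp at ha'
    · have : w = w' := by
        refine List.map_injective_iff.2 ?_ h'
        intro a b hab
        simpa using hab
      rw [this]; exact hw'
    · have : (.inl none : Option σ ⊕ V ⊕ Option U) ∈
        w.map (fun u => (.inr (.inr (some u)) : Option σ ⊕ V ⊕ Option U)) := by
        refine (congrArg (fun l => _ ∈ l) h').mpr ?_
        simp
      simp at this
    · have : (.inl (some (M.eval ts)) : Option σ ⊕ V ⊕ Option U) ∈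
        w.map (fun u => (.inr (.inr (some u)) : Option σ ⊕ V ⊕ Option U)) := by
        refine (congrArg (fun l => _ ∈ l) h').mpr ?_
        simp
      simp at this
end

section
/- If L ⊆ W* is an ET0L language and φ : U* → W* is a monoid homomorphism between free monoids over finite alphabets U and W, then the preimage φ⁻¹(L) ⊆ U* is an ET0L language over U. -/
/-- Applying a table (a finite set of rewriting rules, given for each letter `v`
by the finite set `tab v` of right-hand sides) to a word: every letter is
replaced by some right-hand side of a rule for it, chosen independently for each
occurrence; letters with no rule are left unchanged. -/
inductive TableStep {V : Type} (tab : V → Finset (List V)) : List V → List V → Prop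
  | nil : TableStep tab [] []
  | cons {v : V} {u : List V} {w w' : List V} :
      (u ∈ tab v ∨ (tab v = ∅ ∧ u = [v])) → TableStep tab w w' →
      TableStep tab (v :: w) (u ++ w')

/-- Applying a word of tables in order from left to right. -/
inductive TablesRun {V T : Type} (tab : T → V → Finset (List V)) :
    List T → List V → List V → Prop
  | nil (v : List V) : TablesRun tab [] v v
  | cons {t : T} {ts : List T} {u v w : List V} :
      TableStep (tab t) u v → TablesRun tab ts v w → TablesRun tab (t :: ts) u w

/-- An ET0L system over the terminal alphabet `U` consists of a finite extended
alphabet `V` containing `U`, a finite set `T` of tables for `V`, a regular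
rational control `R ⊆ T*` and an axiom `v₀ ∈ V*`.  A language `L ⊆ U*` is ET0L
if it is the set of words over `U` obtainable from `v₀` by applying the tables
of some word of `R` in order from left to right. -/
def IsET0L {U : Type} [Fintype U] (L : Language U) : Prop :=
  ∃ (V : Type) (_ : Fintype V) (emb : U ↪ V) (T : Type) (_ : Fintype T)
    (tab : T → V → Finset (List V)) (R : Language T) (v₀ : List V),
    R.IsRegular ∧
    L = { w : List U | ∃ ts ∈ R, TablesRun tab ts v₀ (w.map emb) }

namespace ET0LPre

/-- New letters. -/
inductive NL (U V Q : Type) : Type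
  | term (u : U) : NL U V Q
  | fil : NL U V Q
  | start : NL U V Q
  | dead : NL U V Q
  | tri (p : Q) (v : V) (q : Q) : NL U V Q

/-- New tables. -/
inductive NT (T : Type) : Type
  | begn : NT T
  | tab (t : T) : NT T
  | fin : NT T

/-- Control states. -/
inductive CS (S : Type) : Type
  | start : CS S
  | run (s : S) : CS S
  | fin : CS S
  | dead : CS S

instance {U V Q : Type} [Finite U] [Finite V] [Finite Q] : Finite (NL U V Q) := by
  let g : U ⊕ Fin 3 ⊕ (Q × V × Q) → NL U V Q := fun x => match x with
    | .inl u => .term u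
    | .inr (.inl 0) => .fil
    | .inr (.inl 1) => .start
    | .inr (.inl 2) => .dead
    | .inr (.inr (p, v, q)) => .tri p v q
  refine Finite.of_surjective g ?_
  intro y
  cases y with
  | term u => exact ⟨.inl u, rfl⟩
  | fil => exact ⟨.inr (.inl 0), rfl⟩
  | start => exact ⟨.inr (.inl 1), rfl⟩
  | dead => exact ⟨.inr (.inl 2), rfl⟩
  | tri p v q => exact ⟨.inr (.inr (p, v, q)), rfl⟩

instance {T : Type} [Finite T] : Finite (NT T) := by
  let g : Option (Option T) → NT T := fun x => match x with
    | none => .begn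
    | some none => .fin
    | some (some t) => .tab t
  refine Finite.of_surjective g ?_
  intro y
  cases y with
  | begn => exact ⟨none, rfl⟩
  | fin => exact ⟨some none, rfl⟩
  | tab t => exact ⟨some (some t), rfl⟩

instance {S : Type} [Finite S] : Finite (CS S) := by
  let g : Option (Option (Option S)) → CS S := fun x => match x with
    | none => .start
    | some none => .fin
    | some (some none) => .dead
    | some (some (some t)) => .run t
  refine Finite.of_surjective g ?_
  intro y
  cases y with
  | start => exact ⟨none, rfl⟩
  | fin => exact ⟨some none, rfl⟩
  | dead => exact ⟨some (some none), rfl⟩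
  | run t => exact ⟨some (some (some t)), rfl⟩

open Classical in
/-- The control automaton. -/
noncomputable def ctl {T S : Type} (M : DFA T S) : DFA (NT T) (CS S) where
  step x a := match x, a with
    | .start, .begn => .run M.start
    | .run s, .tab t => .run (M.step s t)
    | .run s, .fin => if s ∈ M.accept then .fin else .dead
    | .fin, .fin => .fin
    | _, _ => .dead
  start := .start
  accept := {.fin}

section ctl
variable {T S : Type} (M : DFA T S)

theorem ctl_dead (l : List (NT T)) : (ctl M).evalFrom .dead l = .dead := by
  induction l with
  | nil => rfl
  | cons a l ih => rw [DFA.evalFrom_cons]; exact ih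

theorem ctl_fin (l : List (NT T)) :
    (ctl M).evalFrom .fin l = .fin ↔ ∃ n, l = List.replicate n .fin := by
  induction l with
  | nil => simp [DFA.evalFrom]
  | cons a l ih =>
    rw [DFA.evalFrom_cons]
    cases a with
    | fin =>
      refine Iff.trans ih ⟨?_, ?_⟩
      · rintro ⟨n, rfl⟩; exact ⟨n + 1, rfl⟩
      · rintro ⟨n, h⟩
        cases n with
        | zero => simp at h
        | succ n => exact ⟨n, by simpa [List.replicate_succ] using h⟩
    | begn =>
      refine iff_of_false (fun h => ?_) ?_
      · have := (ctl_dead M l).symm.trans h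
        cases this
      · rintro ⟨n, h⟩
        cases n <;> simp [List.replicate_succ] at h
    | tab t =>
      refine iff_of_false (fun h => ?_) ?_
      · have := (ctl_dead M l).symm.trans h
        cases this
      · rintro ⟨n, h⟩
        cases n <;> simp [List.replicate_succ] at h

theorem ctl_run (l : List (NT T)) : ∀ s : S,
    (ctl M).evalFrom (.run s) l = .fin ↔ ∃ ts n, M.evalFrom s ts ∈ M.accept ∧
      l = ts.map .tab ++ List.replicate (n + 1) .fin := by
  induction l with
  | nil => intro s; simp [DFA.evalFrom]
  | cons a l ih =>
    intro s
    rw [DFA.evalFrom_cons]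
    cases a with
    | fin =>
      by_cases hs : s ∈ M.accept
      · have : (ctl M).step (.run s) .fin = .fin := by simp [ctl, hs]
        rw [this, ctl_fin]
        constructor
        · rintro ⟨n, rfl⟩
          exact ⟨[], n, hs, rfl⟩
        · rintro ⟨ts, n, h1, h2⟩
          cases ts with
          | nil => exact ⟨n, by simpa [List.replicate_succ] using h2⟩
          | cons t ts => simp at h2
      · have : (ctl M).step (.run s) .fin = .dead := by simp [ctl, hs]
        rw [this, ctl_dead]
        refine iff_of_false (by simp) ?_
        rintro ⟨ts, n, h1, h2⟩
        cases ts with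
        | nil => exact hs h1
        | cons t ts => simp at h2
    | begn =>
      refine iff_of_false (fun h => ?_) ?_
      · have := (ctl_dead M l).symm.trans h
        cases this
      · rintro ⟨ts, n, h1, h2⟩
        cases ts <;> simp [List.replicate_succ] at h2
    | tab t =>
      refine Iff.trans (ih (M.step s t)) ⟨?_, ?_⟩
      · rintro ⟨ts, n, h1, rfl⟩
        exact ⟨t :: ts, n, h1, rfl⟩
      · rintro ⟨ts, n, h1, h2⟩
        cases ts with
        | nil => simp [List.replicate_succ] at h2
        | cons t' ts =>
          simp only [List.map_cons, List.cons_append, List.cons.injEq, NT.tab.injEq] at h2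
          obtain ⟨rfl, h2⟩ := h2
          exact ⟨ts, n, h1, h2⟩

theorem ctl_accepts (l : List (NT T)) : l ∈ (ctl M).accepts ↔
    ∃ ts n, ts ∈ M.accepts ∧ l = .begn :: (ts.map .tab ++ List.replicate (n + 1) .fin) := by
  change (ctl M).evalFrom .start l = .fin ↔ _
  cases l with
  | nil => simp [DFA.evalFrom]
  | cons a l =>
    rw [DFA.evalFrom_cons]
    cases a with
    | begn =>
      refine Iff.trans (ctl_run M l M.start) ?_
      simp [DFA.mem_accepts, DFA.eval]
    | tab t =>
      refine iff_of_false (fun h => ?_) (by simp)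
      have := (ctl_dead M l).symm.trans h
      cases this
    | fin =>
      refine iff_of_false (fun h => ?_) (by simp)
      have := (ctl_dead M l).symm.trans h
      cases this

end ctl

/-- `Lab p xs q l`: `xs` is a path from `p` to `q` labelled with the letters of `l`. -/
inductive Lab {U V Q : Type} : Q → List (NL U V Q) → Q → List V → Prop
  | nil (p : Q) : Lab p [] p []
  | cons {p q r : Q} {v : V} {xs : List (NL U V Q)} {l : List V} :
      Lab q xs r l → Lab p (.tri p v q :: xs) r (v :: l)

section lab
variable {U V Q : Type}

theorem Lab.length_eq {p q : Q} {xs : List (NL U V Q)} {l : List V} (h : Lab p xs q l) :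
    xs.length = l.length := by
  induction h with
  | nil => rfl
  | cons _ ih => simp [ih]

theorem Lab.append {p q r : Q} {xs ys : List (NL U V Q)} {l m : List V}
    (h : Lab p xs q l) (h' : Lab q ys r m) : Lab p (xs ++ ys) r (l ++ m) := by
  induction h with
  | nil => exact h'
  | cons _ ih => exact .cons (ih h')

theorem Lab.split {q : Q} {b : List V} : ∀ (a : List V) {p : Q} {ys : List (NL U V Q)},
    Lab p ys q (a ++ b) →
    ∃ ys1 ys2 m, ys = ys1 ++ ys2 ∧ Lab p ys1 m a ∧ Lab m ys2 q b := by
  intro a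
  induction a with
  | nil => intro p ys h; exact ⟨[], ys, p, rfl, .nil p, h⟩
  | cons v a ih =>
    intro p ys h
    cases h with
    | cons h =>
      obtain ⟨ys1, ys2, m, rfl, h1, h2⟩ := ih h
      exact ⟨_ :: ys1, ys2, m, rfl, .cons h1, h2⟩

theorem finite_lab [Finite U] [Finite V] [Finite Q] (p q : Q) (l : List V) :
    {ys : List (NL U V Q) | Lab p ys q l}.Finite :=
  (List.finite_length_eq (NL U V Q) l.length).subset fun _ h => h.length_eq

end lab

/-- States: words of length at most `N`. -/
abbrev St (W : Type) (N : ℕ) : Type := {s : List W // s.length ≤ N}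

instance {W : Type} [Finite W] {N : ℕ} : Finite (St W N) :=
  (List.finite_length_le W N).to_subtype

/-- The empty state. -/
def q0 {W : Type} {N : ℕ} : St W N := ⟨[], Nat.zero_le _⟩

section sys
variable {U W V T : Type} {N : ℕ} (f : U → List W) (emb : W ↪ V)
  (tab : T → V → Finset (List V)) (v₀ : List V)

/-- Rules of the new system. -/
def rules : NT T → NL U V (St W N) → Set (List (NL U V (St W N)))
  | .begn, .start => insert [.dead] {ys | Lab q0 ys q0 v₀}
  | .tab t, .tri p v q => insert [.dead]
      (⋃ y ∈ {y | y ∈ tab t v ∨ (tab t v = ∅ ∧ y = [v])}, {ys | Lab p ys q y})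
  | .fin, .fil => insert [] (insert [.fil]
      (Set.image (fun e => [.term e, .fil]) {e | f e = []}))
  | .fin, .tri p v q => insert [.dead]
      (Set.image (fun u => [.term u, .fil]) {u | p.1 = [] ∧ ∃ w, v = emb w ∧ f u = w :: q.1} ∪
        {x | x = [] ∧ ∃ w, v = emb w ∧ p.1 = w :: q.1})
  | _, _ => ∅

theorem ins_ne {X : Type} (a : X) (s : Set X) : (insert a s = ∅) ↔ False :=
  iff_of_false (Set.insert_nonempty a s).ne_empty id

theorem finite_rules [Finite U] [Finite W] [Finite V] (τ : NT T) (x : NL U V (St W N)) :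
    (rules f emb tab v₀ τ x).Finite := by
  cases τ <;> cases x <;> simp only [rules] <;> try exact Set.finite_empty
  · exact (finite_lab _ _ _).insert _
  · refine Set.Finite.insert _ (Set.Finite.biUnion ?_ fun y _ => finite_lab _ _ _)
    rename_i t p v q
    refine ((tab t v).finite_toSet.union (Set.finite_singleton [v])).subset ?_
    rintro y (h | h)
    · exact Or.inl h
    · exact Or.inr h.2
  · exact ((Set.toFinite _).image _).insert _ |>.insert _
  · refine (((Set.toFinite _).image _).union ?_).insert _
    exact (Set.finite_singleton []).subset fun x h => h.1

variable [Finite U] [Finite W] [Finite V]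

/-- Tables of the new system. -/
noncomputable def ntab (τ : NT T) (x : NL U V (St W N)) : Finset (List (NL U V (St W N))) :=
  (finite_rules f emb tab v₀ τ x).toFinset

theorem mem_ntab {τ : NT T} {x : NL U V (St W N)} {y} :
    y ∈ ntab f emb tab v₀ τ x ↔ y ∈ rules f emb tab v₀ τ x := by
  simp [ntab]

theorem ntab_eq_empty {τ : NT T} {x : NL U V (St W N)} :
    ntab f emb tab v₀ τ x = ∅ ↔ rules f emb tab v₀ τ x = ∅ := by
  simp [ntab]

theorem dead_step {τ : NT T} {x y : List (NL U V (St W N))}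
    (h : TableStep (ntab f emb tab v₀ τ) x y) (hx : .dead ∈ x) : .dead ∈ y := by
  induction h with
  | nil => exact hx
  | @cons v u w w' hr _ ih =>
    rw [List.mem_append]
    rcases List.mem_cons.1 hx with rfl | hx
    · left
      rcases hr with hr | hr
      · rw [mem_ntab] at hr
        cases τ <;> simp [rules] at hr
      · simp [hr.2]
    · exact Or.inr (ih hx)

theorem dead_run {τs : List (NT T)} {x y : List (NL U V (St W N))}
    (h : TablesRun (ntab f emb tab v₀) τs x y) (hx : .dead ∈ x) : .dead ∈ y := by
  induction h with
  | nil => exact hx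
  | cons hs _ ih => exact ih (dead_step f emb tab v₀ hs hx)

theorem step_append {X : Type} {tb : X → Finset (List X)} {a b c d : List X}
    (h : TableStep tb a b) (h' : TableStep tb c d) : TableStep tb (a ++ c) (b ++ d) := by
  induction h with
  | nil => exact h'
  | cons hr _ ih => rw [List.append_assoc]; exact .cons hr ih

theorem run_append {X Y : Type} {tb : Y → X → Finset (List X)} {a b c : List X} {k l : List Y}
    (h : TablesRun tb k a b) (h' : TablesRun tb l b c) : TablesRun tb (k ++ l) a c := by
  induction h with
  | nil => exact h'
  | cons hs _ ih => exact .cons hs (ih h')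

theorem run_split {X Y : Type} {tb : Y → X → Finset (List X)} {c : List X} {l : List Y} :
    ∀ (k : List Y) {a : List X}, TablesRun tb (k ++ l) a c →
      ∃ b, TablesRun tb k a b ∧ TablesRun tb l b c := by
  intro k
  induction k with
  | nil => intro a h; exact ⟨a, .nil a, h⟩
  | cons t k ih =>
    intro a h
    cases h with
    | cons hs h =>
      obtain ⟨b, h1, h2⟩ := ih h
      exact ⟨b, .cons hs h1, h2⟩

/-! Simulation of original tables. -/

theorem sim_back {t : T} {p q : St W N} {xs : List (NL U V (St W N))} {x : List V}
    (h : Lab p xs q x) : ∀ {ys}, TableStep (ntab f emb tab v₀ (.tab t)) xs ys → .dead ∉ ys →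
      ∃ y, Lab p ys q y ∧ TableStep (tab t) x y := by
  induction h with
  | nil p => intro ys hs _; cases hs; exact ⟨[], .nil p, .nil⟩
  | cons _ ih =>
    intro ys hs hd
    cases hs with
    | cons hr hs =>
      rw [List.mem_append, not_or] at hd
      obtain ⟨y', h1, h2⟩ := ih hs hd.2
      rw [mem_ntab, ntab_eq_empty] at hr
      simp only [rules, ins_ne, false_and, or_false] at hr
      rcases hr with rfl | hr
      · simp at hd
      · simp only [Set.mem_iUnion] at hr
        obtain ⟨y, hy, hl⟩ := hr
        exact ⟨y ++ y', Lab.append hl h1, .cons hy h2⟩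

theorem sim_forw {t : T} {q : St W N} {x y : List V} (h : TableStep (tab t) x y) :
    ∀ {p : St W N} {ys : List (NL U V (St W N))}, Lab p ys q y →
      ∃ xs, Lab p xs q x ∧ TableStep (ntab f emb tab v₀ (.tab t)) xs ys := by
  induction h with
  | nil => intro p ys h; cases h; exact ⟨[], .nil _, .nil⟩
  | @cons v u w w' hr _ ih =>
    intro p ys h
    obtain ⟨ys1, ys2, m, rfl, h1, h2⟩ := Lab.split u h
    obtain ⟨xs, h3, h4⟩ := ih h2
    refine ⟨.tri p v m :: xs, .cons h3, .cons (Or.inl ?_) h4⟩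
    rw [mem_ntab]
    simp only [rules]
    refine Or.inr ?_
    simp only [Set.mem_iUnion]
    exact ⟨u, hr, h1⟩

theorem fil_tab {t : T} {xs z : List (NL U V (St W N))} :
    TableStep (ntab f emb tab v₀ (.tab t)) (.fil :: xs) z ↔
      ∃ ys, z = .fil :: ys ∧ TableStep (ntab f emb tab v₀ (.tab t)) xs ys := by
  constructor
  · intro h
    cases h with
    | cons hr h =>
      rw [mem_ntab, ntab_eq_empty] at hr
      simp [rules] at hr
      subst hr
      exact ⟨_, rfl, h⟩
  · rintro ⟨ys, rfl, h⟩
    refine TableStep.cons (u := [NL.fil]) (Or.inr ⟨?_, rfl⟩) h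
    rw [ntab_eq_empty]; simp [rules]

theorem run_back (ts : List T) : ∀ {p q : St W N} {xs : List (NL U V (St W N))} {x : List V}
    {z}, Lab p xs q x → TablesRun (ntab f emb tab v₀) (ts.map .tab) (.fil :: xs) z → .dead ∉ z →
      ∃ ys y, z = .fil :: ys ∧ Lab p ys q y ∧ TablesRun tab ts x y := by
  induction ts with
  | nil => intro p q xs x z hl h _; cases h; exact ⟨xs, x, rfl, hl, .nil _⟩
  | cons t ts ih =>
    intro p q xs x z hl h hd
    cases h with
    | cons hs h =>
      obtain ⟨ys, rfl, hs'⟩ := (fil_tab f emb tab v₀).1 hs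
      have hd' : NL.dead ∉ ys := fun hh =>
        hd (dead_run f emb tab v₀ h (List.mem_cons_of_mem _ hh))
      obtain ⟨y, h1, h2⟩ := sim_back f emb tab v₀ hl hs' hd'
      obtain ⟨ys', y', h3, h4, h5⟩ := ih h1 h hd
      exact ⟨ys', y', h3, h4, .cons h2 h5⟩

theorem run_forw {q : St W N} {ts : List T} {x y : List V} (h : TablesRun tab ts x y) :
    ∀ {p : St W N} {ys : List (NL U V (St W N))}, Lab p ys q y →
      ∃ xs, Lab p xs q x ∧
        TablesRun (ntab f emb tab v₀) (ts.map .tab) (.fil :: xs) (.fil :: ys) := by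
  induction h with
  | nil => intro p ys h; exact ⟨ys, h, .nil _⟩
  | cons hs _ ih =>
    intro p ys h
    obtain ⟨zs, h1, h2⟩ := ih h
    obtain ⟨xs, h3, h4⟩ := sim_forw f emb tab v₀ hs h1
    exact ⟨xs, h3, .cons ((fil_tab f emb tab v₀).2 ⟨_, rfl, h4⟩) h2⟩

/-! The final phase. -/

/-- Letters left after the first application of the final table. -/
def UF : NL U V (St W N) → Prop
  | .term _ => True
  | .fil => True
  | _ => False

/-- The value of a letter. -/
def val : NL U V (St W N) → List W
  | .term u => f u
  | _ => []

theorem fin_self {z : List (NL U V (St W N))} (hz : ∀ a ∈ z, UF a) :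
    TableStep (ntab f emb tab v₀ .fin) z z := by
  induction z with
  | nil => exact .nil
  | cons a z ih =>
    refine TableStep.cons (u := [a]) ?_ (ih fun b hb => hz b (List.mem_cons_of_mem _ hb))
    have := hz a List.mem_cons_self
    rw [mem_ntab, ntab_eq_empty]
    cases a <;> simp [UF] at this <;> simp [rules]

theorem fin_back {p q : St W N} {ys : List (NL U V (St W N))} {y : List V} (h : Lab p ys q y) :
    ∀ {z}, TableStep (ntab f emb tab v₀ .fin) ys z → .dead ∉ z →
      (∀ a ∈ z, UF a) ∧ ∃ w, y = w.map emb ∧ p.1 ++ z.flatMap (val f) = w ++ q.1 := by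
  induction h with
  | nil p => intro z hs _; cases hs; exact ⟨by simp, [], by simp⟩
  | cons _ ih =>
    intro z hs hd
    cases hs with
    | cons hr hs =>
      rw [List.mem_append, not_or] at hd
      obtain ⟨h1, w, rfl, h2⟩ := ih hs hd.2
      rw [mem_ntab, ntab_eq_empty] at hr
      simp only [rules, ins_ne, false_and, or_false] at hr
      rcases hr with rfl | ⟨u, ⟨hp, b, rfl, hu⟩, rfl⟩ | ⟨rfl, b, rfl, hp⟩
      · simp at hd
      · refine ⟨?_, b :: w, by simp, ?_⟩
        · simpa [UF] using h1
        · simp [hp, val, hu, h2]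
      · refine ⟨by simpa using h1, b :: w, by simp, ?_⟩
        simp [hp, h2]

theorem fin_step_val {z z' : List (NL U V (St W N))}
    (h : TableStep (ntab f emb tab v₀ .fin) z z') (hz : ∀ a ∈ z, UF a) :
      (∀ a ∈ z', UF a) ∧ z'.flatMap (val f) = z.flatMap (val f) := by
  induction h with
  | nil => simp
  | @cons v u w w' hr _ ih =>
    obtain ⟨h1, h2⟩ := ih fun b hb => hz b (List.mem_cons_of_mem _ hb)
    have hv := hz v List.mem_cons_self
    rw [mem_ntab, ntab_eq_empty] at hr
    cases v with
    | term a =>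
      simp [rules] at hr
      subst hr
      exact ⟨by simpa [UF] using h1, by simp [h2]⟩
    | fil =>
      simp only [rules, ins_ne, false_and, or_false] at hr
      rcases hr with rfl | rfl | ⟨e, he, rfl⟩
      · exact ⟨by simpa [UF] using h1, by simp [h2, val]⟩
      · exact ⟨by simpa [UF] using h1, by simp [h2, val]⟩
      · exact ⟨by simpa [UF] using h1, by simpa [h2, val] using he⟩
    | start => exact hv.elim
    | dead => exact hv.elim
    | tri => exact hv.elim

theorem fin_run_val (n : ℕ) : ∀ {z z' : List (NL U V (St W N))},
    TablesRun (ntab f emb tab v₀) (List.replicate n .fin) z z' → (∀ a ∈ z, UF a) →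
      z'.flatMap (val f) = z.flatMap (val f) := by
  induction n with
  | zero => intro z z' h _; cases h; rfl
  | succ n ih =>
    intro z z' h hz
    rw [List.replicate_succ] at h
    cases h with
    | cons hs h =>
      obtain ⟨h1, h2⟩ := fin_step_val f emb tab v₀ hs hz
      rw [ih h h1, h2]

theorem run_term_cons (n : ℕ) (a : U) : ∀ {z z' : List (NL U V (St W N))},
    TablesRun (ntab f emb tab v₀) (List.replicate n .fin) z z' →
    TablesRun (ntab f emb tab v₀) (List.replicate n .fin) (.term a :: z) (.term a :: z') := by
  induction n with
  | zero => intro z z' h; cases h; exact .nil _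
  | succ n ih =>
    intro z z' h
    rw [List.replicate_succ] at h ⊢
    cases h with
    | cons hs h =>
      refine .cons (TableStep.cons (u := [NL.term a]) (Or.inr ⟨?_, rfl⟩) hs) (ih h)
      rw [ntab_eq_empty]; simp [rules]

theorem suffix_path : ∀ (s : List W) (hs : s.length ≤ N),
    ∃ ys : List (NL U V (St W N)), Lab ⟨s, hs⟩ ys q0 (s.map emb) ∧
      TableStep (ntab f emb tab v₀ .fin) ys [] := by
  intro s
  induction s with
  | nil => intro hs; exact ⟨[], .nil _, .nil⟩
  | cons w s ih =>
    intro hs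
    have hs' : s.length ≤ N := by simp at hs; omega
    obtain ⟨ys, h1, h2⟩ := ih hs'
    refine ⟨.tri ⟨w :: s, hs⟩ (emb w) ⟨s, hs'⟩ :: ys, .cons h1,
      TableStep.cons (u := []) (Or.inl ?_) h2⟩
    rw [mem_ntab]
    exact Or.inr (Or.inr ⟨rfl, w, rfl, rfl⟩)

theorem fin_forw (hN : ∀ u, (f u).length ≤ N) (u : List U) :
    ∃ (ys z : List (NL U V (St W N))) (n : ℕ), (∀ a ∈ z, UF a) ∧
      Lab q0 ys q0 ((u.flatMap f).map emb) ∧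
      TableStep (ntab f emb tab v₀ .fin) ys z ∧
      TablesRun (ntab f emb tab v₀) (List.replicate n .fin) (.fil :: z) (u.map .term) := by
  induction u with
  | nil =>
    refine ⟨[], [], 1, by simp, .nil _, .nil, ?_⟩
    refine .cons (TableStep.cons (u := []) (Or.inl ?_) .nil) (.nil _)
    rw [mem_ntab]
    exact Or.inl rfl
  | cons a u ih =>
    obtain ⟨ys, z, n, hz, hl, hs, hr⟩ := ih
    cases hfa : f a with
    | nil =>
      refine ⟨ys, z, n + 1, hz, by simpa [hfa] using hl, hs, ?_⟩
      rw [List.replicate_succ]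
      refine .cons (TableStep.cons (u := [NL.term a, NL.fil]) (Or.inl ?_)
        (fin_self f emb tab v₀ hz)) (run_term_cons f emb tab v₀ n a hr)
      rw [mem_ntab]
      exact Or.inr (Or.inr ⟨a, hfa, rfl⟩)
    | cons w s =>
      have hlen : s.length ≤ N := by
        have := hN a
        rw [hfa] at this
        simp at this; omega
      obtain ⟨ps, h1, h2⟩ := suffix_path f emb tab v₀ s hlen
      refine ⟨.tri q0 (emb w) ⟨s, hlen⟩ :: (ps ++ ys), .term a :: .fil :: z, n + 1, ?_, ?_, ?_, ?_⟩
      · simpa [UF] using hz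
      · have := Lab.cons (p := q0) (v := emb w) (h1.append hl)
        simpa [hfa] using this
      · refine TableStep.cons (u := [NL.term a, NL.fil]) (w' := z) (Or.inl ?_) (step_append h2 hs)
        rw [mem_ntab]
        exact Or.inr (Or.inl ⟨a, ⟨rfl, w, rfl, hfa⟩, rfl⟩)
      · rw [List.replicate_succ]
        refine .cons (TableStep.cons (u := []) (w' := NL.term a :: NL.fil :: z) (Or.inl ?_)
          (fin_self f emb tab v₀ ?_)) (run_term_cons f emb tab v₀ n a hr)
        · rw [mem_ntab]
          exact Or.inl rfl
        · simpa [UF] using hz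

theorem init_step {z : List (NL U V (St W N))} (hd : .dead ∉ z) :
    TableStep (ntab f emb tab v₀ .begn) [.fil, .start] z ↔
      ∃ xs, z = .fil :: xs ∧ Lab q0 xs q0 v₀ := by
  constructor
  · intro h
    cases h with
    | cons hr h =>
      rw [mem_ntab, ntab_eq_empty] at hr
      simp [rules] at hr
      subst hr
      cases h with
      | cons hr h =>
        cases h
        rw [mem_ntab, ntab_eq_empty] at hr
        simp only [rules, ins_ne, false_and, or_false] at hr
        rcases hr with rfl | hr
        · simp at hd
        · exact ⟨_, rfl, by simpa using hr⟩
  · rintro ⟨xs, rfl, h⟩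
    refine TableStep.cons (u := [NL.fil]) (Or.inr ⟨?_, rfl⟩) ?_
    · rw [ntab_eq_empty]; simp [rules]
    · rw [← List.append_nil xs]
      refine TableStep.cons (Or.inl ?_) .nil
      rw [mem_ntab]
      exact Or.inr h

theorem Lab.not_dead {p q : St W N} {xs : List (NL U V (St W N))} {l : List V}
    (h : Lab p xs q l) : .dead ∉ xs := by
  induction h with
  | nil => simp
  | cons _ ih => simpa using ih

theorem main_iff (hN : ∀ u, (f u).length ≤ N) {S : Type} (M : DFA T S) (u : List U) :
    (∃ ts ∈ M.accepts, TablesRun tab ts v₀ ((u.flatMap f).map emb)) ↔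
    ∃ τs ∈ (ctl M).accepts, TablesRun (ntab (N := N) f emb tab v₀) τs [.fil, .start]
      (u.map .term) := by
  constructor
  · rintro ⟨ts, hts, hrun⟩
    obtain ⟨ys, z, n, hz, hl, hs, hr⟩ := fin_forw (N := N) f emb tab v₀ hN u
    obtain ⟨xs, hx, hrun'⟩ := run_forw f emb tab v₀ hrun hl
    refine ⟨_, (ctl_accepts M _).2 ⟨ts, n, hts, rfl⟩, ?_⟩
    refine .cons ((init_step f emb tab v₀ ?_).2 ⟨xs, rfl, hx⟩) (run_append hrun' ?_)
    · simpa using Lab.not_dead hx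
    · rw [List.replicate_succ]
      refine .cons (TableStep.cons (u := [NL.fil]) (Or.inl ?_) hs) hr
      rw [mem_ntab]
      exact Or.inr (Or.inl rfl)
  · rintro ⟨τs, hτ, hrun⟩
    obtain ⟨ts, n, hts, rfl⟩ := (ctl_accepts M _).1 hτ
    refine ⟨ts, hts, ?_⟩
    have hd : (NL.dead : NL U V (St W N)) ∉ u.map NL.term := by simp
    cases hrun with
    | cons hi hrun =>
      have hd1 := fun hh => hd (dead_run f emb tab v₀ hrun hh)
      obtain ⟨xs, rfl, hx⟩ := (init_step f emb tab v₀ hd1).1 hi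
      obtain ⟨b, h1, h2⟩ := run_split _ hrun
      have hd2 := fun hh => hd (dead_run f emb tab v₀ h2 hh)
      obtain ⟨ys, y, rfl, hy, hyr⟩ := run_back f emb tab v₀ ts hx h1 hd2
      rw [List.replicate_succ] at h2
      cases h2 with
      | cons hs h2 =>
        have hd3 : ¬ _ := fun hh => hd (dead_run f emb tab v₀ h2 hh)
        cases hs with
        | @cons _ c _ z hr hs =>
          rw [List.mem_append, not_or] at hd3
          obtain ⟨g1, w, rfl, g2⟩ := fin_back f emb tab v₀ hy hs hd3.2
          have hc : TableStep (ntab f emb tab v₀ .fin) [.fil] c := by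
            rw [← List.append_nil c]; exact .cons hr .nil
          obtain ⟨k1, k2⟩ := fin_step_val f emb tab v₀ hc (by simp [UF])
          have := fin_run_val f emb tab v₀ n h2 (by
            intro a ha
            rcases List.mem_append.1 ha with ha | ha
            · exact k1 a ha
            · exact g1 a ha)
          rw [List.flatMap_append, k2] at this
          simp only [q0, List.nil_append, List.append_nil] at g2
          rw [g2, List.flatMap_map] at this
          have e : u.flatMap f = w := by simpa [val] using this
          rw [e]
          exact hyr

end sys

end ET0LPre


/-- The preimage of an ET0L language under a homomorphism of free monoids over
finite alphabets is ET0L. -/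
theorem isET0L_preimage {U W : Type} [Fintype U] [Fintype W] (L : Language W)
    (hL : IsET0L L) (φ : FreeMonoid U →* FreeMonoid W) :
    IsET0L { u : List U | FreeMonoid.toList (φ (FreeMonoid.ofList u)) ∈ L } := by
  classical
  obtain ⟨V, _, emb, T, _, tab, R, v₀, ⟨S, _, M, rfl⟩, rfl⟩ := hL
  let f : U → List W := fun u => FreeMonoid.toList (φ (FreeMonoid.of u))
  have hf : ∀ u : List U, FreeMonoid.toList (φ (FreeMonoid.ofList u)) = u.flatMap f := by
    intro u
    induction u with
    | nil => simp
    | cons a u ih =>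
      rw [FreeMonoid.ofList_cons, map_mul, FreeMonoid.toList_mul, ih]
      rfl
  let N : ℕ := ∑ u : U, (f u).length
  have hN : ∀ u, (f u).length ≤ N := fun u =>
    Finset.single_le_sum (f := fun u => (f u).length) (fun _ _ => Nat.zero_le _)
      (Finset.mem_univ u)
  refine ⟨ET0LPre.NL U V (ET0LPre.St W N), Fintype.ofFinite _,
    ⟨ET0LPre.NL.term, fun a b h => by cases h; rfl⟩, ET0LPre.NT T, Fintype.ofFinite _,
    ET0LPre.ntab f emb tab v₀, (ET0LPre.ctl M).accepts, [.fil, .start],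
    ⟨ET0LPre.CS S, Fintype.ofFinite _, ET0LPre.ctl M, rfl⟩, ?_⟩
  ext u
  refine Iff.trans ?_ (ET0LPre.main_iff f emb tab v₀ hN M u)
  rw [← hf u]
  rfl
end
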